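/- arXiv:math/0210259 — 2 statements merged into one kernel-verified Lean document; each statement's English description precedes it below -/
import Mathlib

section
/- Getzler identity: in a pre-operad C, the associator of the total composition satisfies (h•f)•g − h•(f•g) = {h,f,g} + (−1)^{|f||g|}{h,g,f} for all homogeneous h, f, g. -/
/-- A linear pre-operad (composition system) over a commutative ring `K`:
a sequence of `K`-modules `C n` with partial compositions
`∘ᵢ : C m ⊗ C n → C (m+n-1)` (for `0 ≤ i ≤ m-1`), composition relations,
and a unit `𝕀 ∈ C 1`.  Signs `(-1)^{|f||g|}` are written with exponents of the
same parity, e.g. `(m+1)*(n+1) ≡ (m-1)*(n-1) (mod 2)`. -/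
structure PreOperad (K : Type*) [CommRing K] where
  C : ℕ → Type*
  addCommGroup : ∀ n, AddCommGroup (C n)
  module : ∀ n, letI := addCommGroup n; Module K (C n)
  comp : ∀ {m n : ℕ}, C m → ℕ → C n → C (m + n - 1)
  comp_add_left : ∀ {m n : ℕ} (i : ℕ) (g : C n),
    letI := addCommGroup m; letI := addCommGroup (m + n - 1);
    ∀ f₁ f₂ : C m, comp (f₁ + f₂) i g = comp f₁ i g + comp f₂ i g
  comp_add_right : ∀ {m n : ℕ} (f : C m) (i : ℕ),
    letI := addCommGroup n; letI := addCommGroup (m + n - 1);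
    ∀ g₁ g₂ : C n, comp f i (g₁ + g₂) = comp f i g₁ + comp f i g₂
  comp_smul_left : ∀ {m n : ℕ} (a : K) (i : ℕ) (g : C n),
    letI := addCommGroup m; letI := module m;
    letI := addCommGroup (m + n - 1); letI := module (m + n - 1);
    ∀ f : C m, comp (a • f) i g = a • comp f i g
  comp_smul_right : ∀ {m n : ℕ} (f : C m) (i : ℕ) (a : K),
    letI := addCommGroup n; letI := module n;
    letI := addCommGroup (m + n - 1); letI := module (m + n - 1);
    ∀ g : C n, comp f i (a • g) = a • comp f i g
  unit : C 1
  unit_comp : ∀ {n : ℕ} (f : C n),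
    (show 1 + n - 1 = n by omega) ▸ comp unit 0 f = f
  comp_unit : ∀ {n : ℕ} (f : C n) (i : ℕ), i < n → comp f i unit = f
  /-- `(h∘ᵢf)∘ⱼg = (-1)^{|f||g|}(h∘ⱼg)∘_{i+|g|}f` for `0 ≤ j ≤ i-1`. -/
  assoc₁ : ∀ {p m n : ℕ} (h : C p) (f : C m) (g : C n) (i j : ℕ)
    (h₁ : j < i) (h₂ : i < p) (h₃ : 1 ≤ n),
    letI := addCommGroup ((p + n - 1) + m - 1);
    comp (comp h i f) j g =
      (show (p + n - 1) + m - 1 = (p + m - 1) + n - 1 by omega) ▸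
        (((-1 : ℤ) ^ ((m + 1) * (n + 1))) • comp (comp h j g) (i + n - 1) f)
  /-- `(h∘ᵢf)∘ⱼg = h∘ᵢ(f∘_{j-i}g)` for `i ≤ j ≤ i+|f|`. -/
  assoc₂ : ∀ {p m n : ℕ} (h : C p) (f : C m) (g : C n) (i j : ℕ)
    (h₁ : i < p) (h₂ : 1 ≤ m) (h₃ : i ≤ j) (h₄ : j ≤ i + m - 1),
    comp (comp h i f) j g =
      (show p + (m + n - 1) - 1 = (p + m - 1) + n - 1 by omega) ▸
        comp h i (comp f (j - i) g)
  /-- `(h∘ᵢf)∘ⱼg = (-1)^{|f||g|}(h∘_{j-|f|}g)∘ᵢf` for `i+f ≤ j ≤ |h|+|f|`. -/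
  assoc₃ : ∀ {p m n : ℕ} (h : C p) (f : C m) (g : C n) (i j : ℕ)
    (h₁ : i < p) (h₂ : 1 ≤ m) (h₃ : i + m ≤ j) (h₄ : j ≤ (p - 1) + (m - 1)),
    letI := addCommGroup ((p + n - 1) + m - 1);
    comp (comp h i f) j g =
      (show (p + n - 1) + m - 1 = (p + m - 1) + n - 1 by omega) ▸
        (((-1 : ℤ) ^ ((m + 1) * (n + 1))) • comp (comp h (j - (m - 1)) g) i f)

attribute [instance] PreOperad.addCommGroup PreOperad.module

namespace PreOperad

variable {K : Type*} [CommRing K] (o : PreOperad K)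

/-- Transport along an equality of degrees. -/
def nCast {m n : ℕ} (h : m = n) (x : o.C m) : o.C n := h ▸ x

/-- Total composition `f•g := Σ_{i=0}^{|f|} f∘ᵢg`. -/
def tot {m n : ℕ} (f : o.C m) (g : o.C n) : o.C (m + n - 1) :=
  ∑ i ∈ Finset.range m, o.comp f i g

/-- Cup multiplication `f ⌣ g := (-1)^f (μ∘₀f)∘_f g`. -/
def cup (μ : o.C 2) {m n : ℕ} (f : o.C m) (g : o.C n) : o.C (m + n) :=
  ((-1 : ℤ) ^ m) •
    o.nCast (by omega)
      (o.comp (o.nCast (show 2 + m - 1 = m + 1 by omega) (o.comp μ 0 f)) m g)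

/-- Graded commutator `[f,g] := f•g - (-1)^{|f||g|} g•f`. -/
def bracket {m n : ℕ} (f : o.C m) (g : o.C n) : o.C (m + n - 1) :=
  o.tot f g - ((-1 : ℤ) ^ ((m + 1) * (n + 1))) • o.nCast (by omega) (o.tot g f)

/-- Gerstenhaber tribraces `{h,f,g} := Σ_{i=0}^{|h|-1} Σ_{j=i+f}^{|f|+|h|} (h∘ᵢf)∘ⱼg`. -/
def tribrace {p m n : ℕ} (h : o.C p) (f : o.C m) (g : o.C n) :
    o.C ((p + m - 1) + n - 1) :=
  ∑ i ∈ Finset.range (p - 1), ∑ j ∈ Finset.Icc (i + m) ((m - 1) + (p - 1)),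
    o.comp (o.comp h i f) j g

/-- Tetrabraces `{h,f,g,b}`. -/
def tetrabrace {p m n q : ℕ} (h : o.C p) (f : o.C m) (g : o.C n) (b : o.C q) :
    o.C (((p + m - 1) + n - 1) + q - 1) :=
  ∑ i ∈ Finset.range (p - 2), ∑ j ∈ Finset.Icc (i + m) ((p - 1) + (m - 1) - 1),
    ∑ k ∈ Finset.Icc (j + n) ((p - 1) + (m - 1) + (n - 1)),
      o.comp (o.comp (o.comp h i f) j g) k b

/-- Pre-coboundary operator `δf := -[f,μ] = -(f•μ - (-1)^{|f|} μ•f)`. -/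
def delta (μ : o.C 2) {m : ℕ} (f : o.C m) : o.C (m + 1) :=
  -(o.tot f μ) + ((-1 : ℤ) ^ (m + 1)) • o.nCast (by omega) (o.tot μ f)

end PreOperad

namespace PreOperad
variable {K : Type*} [CommRing K] (o : PreOperad K)

/-- Transport along an equality of degrees as an additive homomorphism. -/
def nCastHom {m n : ℕ} (h : m = n) : o.C m →+ o.C n where
  toFun := o.nCast h
  map_zero' := by subst h; rfl
  map_add' := by subst h; intros; rfl

theorem nCast_sum {ι : Type*} {m n : ℕ} (h : m = n) (s : Finset ι) (x : ι → o.C m) :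
    o.nCast h (∑ i ∈ s, x i) = ∑ i ∈ s, o.nCast h (x i) :=
  map_sum (o.nCastHom h) x s

theorem nCast_zsmul {m n : ℕ} (h : m = n) (a : ℤ) (x : o.C m) :
    o.nCast h (a • x) = a • o.nCast h x :=
  map_zsmul (o.nCastHom h) a x

theorem sum_comp {ι : Type*} {m n : ℕ} (s : Finset ι) (f : ι → o.C m) (j : ℕ) (g : o.C n) :
    o.comp (∑ i ∈ s, f i) j g = ∑ i ∈ s, o.comp (f i) j g :=
  map_sum (AddMonoidHom.mk' (fun x : o.C m => o.comp x j g) (o.comp_add_left j g)) f s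

theorem comp_sum {ι : Type*} {m n : ℕ} (s : Finset ι) (f : o.C m) (j : ℕ) (g : ι → o.C n) :
    o.comp f j (∑ i ∈ s, g i) = ∑ i ∈ s, o.comp f j (g i) :=
  map_sum (AddMonoidHom.mk' (fun x : o.C n => o.comp f j x) (o.comp_add_right f j)) g s

theorem tot_tot {p m n : ℕ} (h : o.C p) (f : o.C m) (g : o.C n) :
    o.tot (o.tot h f) g =
      ∑ i ∈ Finset.range p, ∑ j ∈ Finset.range (p + m - 1), o.comp (o.comp h i f) j g := by
  simp only [tot, sum_comp]
  exact Finset.sum_comm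

/-- Composing in the slots of `f` inside `h ∘ᵢ f` yields `h • (f • g)`. -/
theorem sum_nested_eq_tot_tot {p m n : ℕ} (hm : 1 ≤ m) (h : o.C p) (f : o.C m) (g : o.C n)
    (e : p + (m + n - 1) - 1 = p + m - 1 + n - 1) :
    ∑ i ∈ Finset.range p, ∑ j ∈ Finset.Ico i (i + m), o.comp (o.comp h i f) j g =
      o.nCast e (o.tot h (o.tot f g)) := by
  simp only [tot, comp_sum, nCast_sum]
  refine Finset.sum_congr rfl fun i hi => ?_
  rw [Finset.sum_Ico_eq_sum_range, Nat.add_sub_cancel_left]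
  refine Finset.sum_congr rfl fun k hk => ?_
  rw [Finset.mem_range] at hi hk
  rw [o.assoc₂ h f g i (i + k) hi hm (by omega) (by omega), Nat.add_sub_cancel_left]
  rfl

theorem sum_right_eq_tribrace {p m n : ℕ} (hp : 1 ≤ p) (hm : 1 ≤ m)
    (h : o.C p) (f : o.C m) (g : o.C n) :
    ∑ i ∈ Finset.range p, ∑ j ∈ Finset.Ico (i + m) (p + m - 1), o.comp (o.comp h i f) j g =
      o.tribrace h f g := by
  obtain ⟨q, rfl⟩ := Nat.exists_eq_add_of_le' hp
  have hs : ∀ i, Finset.Ico (i + m) (q + 1 + m - 1) =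
      Finset.Icc (i + m) ((m - 1) + (q + 1 - 1)) := fun i => by
    ext; simp only [Finset.mem_Ico, Finset.mem_Icc]; omega
  rw [Finset.sum_range_succ, Finset.Ico_eq_empty (by omega), Finset.sum_empty, add_zero]
  simp only [tribrace, hs]
  rfl

/-- Composing to the left of `f` in `h ∘ᵢ f` yields the tribrace with `f` and `g` exchanged. -/
theorem sum_left_eq_tribrace {p m n : ℕ} (hn : 1 ≤ n)
    (h : o.C p) (f : o.C m) (g : o.C n) (e : p + n - 1 + m - 1 = p + m - 1 + n - 1) :
    ∑ i ∈ Finset.range p, ∑ j ∈ Finset.range i, o.comp (o.comp h i f) j g =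
      ((-1 : ℤ) ^ ((m + 1) * (n + 1))) • o.nCast e (o.tribrace h g f) := by
  simp only [tribrace, nCast_sum, Finset.smul_sum]
  rw [Finset.sum_sigma', Finset.sum_sigma']
  refine Finset.sum_bij' (fun x _ => ⟨x.2, x.1 + n - 1⟩) (fun x _ => ⟨x.2 + 1 - n, x.1⟩)
    ?_ ?_ ?_ ?_ ?_
  · rintro ⟨i, j⟩ hx
    simp only [Finset.mem_sigma, Finset.mem_range, Finset.mem_Icc] at hx ⊢
    omega
  · rintro ⟨i, j⟩ hx
    simp only [Finset.mem_sigma, Finset.mem_range, Finset.mem_Icc] at hx ⊢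
    omega
  · rintro ⟨i, j⟩ hx
    simp only [Sigma.mk.injEq, heq_eq_eq, and_true]
    omega
  · rintro ⟨i, j⟩ hx
    simp only [Finset.mem_sigma, Finset.mem_range, Finset.mem_Icc] at hx
    simp only [Sigma.mk.injEq, heq_eq_eq, true_and]
    omega
  · rintro ⟨i, j⟩ hx
    simp only [Finset.mem_sigma, Finset.mem_range] at hx
    rw [← nCast_zsmul]
    exact o.assoc₁ h f g i j hx.2 hx.1 hn

/-- Getzler identity: `(h•f)•g - h•(f•g) = {h,f,g} + (-1)^{|f||g|}{h,g,f}`.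
(The exponent `(m+1)*(n+1)` has the same parity as `|f||g| = (m-1)(n-1)`.) -/
theorem getzler_identity {p m n : ℕ} (hp : 1 ≤ p) (hm : 1 ≤ m) (hn : 1 ≤ n)
    (h : o.C p) (f : o.C m) (g : o.C n) :
    o.tot (o.tot h f) g - o.nCast (by omega) (o.tot h (o.tot f g)) =
      o.tribrace h f g +
        ((-1 : ℤ) ^ ((m + 1) * (n + 1))) • o.nCast (by omega) (o.tribrace h g f) := by
  rw [tot_tot, ← o.sum_nested_eq_tot_tot hm, ← o.sum_right_eq_tribrace hp hm,
    ← o.sum_left_eq_tribrace hn, sub_eq_iff_eq_add, ← Finset.sum_add_distrib,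
    ← Finset.sum_add_distrib]
  refine Finset.sum_congr rfl fun i hi => ?_
  rw [Finset.mem_range] at hi
  rw [← Finset.sum_range_add_sum_Ico _ (show i + m ≤ p + m - 1 by omega),
    ← Finset.sum_range_add_sum_Ico _ (show i ≤ i + m by omega)]
  abel

end PreOperad
end

section
/- In a pre-operad C, the commutator [f,g] := f•g − (−1)^{|f||g|} g•f makes C into a graded Lie algebra with respect to reduced degree: it is graded anticommutative, [f,g] = −(−1)^{|f||g|}[g,f], and satisfies the graded Jacobi identity (−1)^{|f||h|}[[f,g],h] + (−1)^{|g||f|}[[g,h],f] + (−1)^{|h||g|}[[h,f],g] = 0. -/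
namespace PreOperad
variable {K : Type*} [CommRing K] (o : PreOperad K)

/-- The inclusion of the degree `n` part into the product of all degrees, which forgets
transports along equalities of degrees. -/
def incl (n : ℕ) : o.C n →+ ∀ k, o.C k := AddMonoidHom.single (fun k => o.C k) n

lemma incl_injective (n : ℕ) : Function.Injective (o.incl n) :=
  Pi.single_injective n

@[simp]
lemma incl_nCast {m n : ℕ} (e : m = n) (x : o.C m) : o.incl n (o.nCast e x) = o.incl m x := by
  subst e; rfl

/-- Partial composition as a biadditive map. -/
def compHom (m n i : ℕ) : o.C m →+ o.C n →+ o.C (m + n - 1) :=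
  AddMonoidHom.mk' (fun f => AddMonoidHom.mk' (fun g => o.comp f i g) (o.comp_add_right f i))
    fun f₁ f₂ => AddMonoidHom.ext fun g => o.comp_add_left i g f₁ f₂

/-- Total composition as a biadditive map. -/
def totHom (m n : ℕ) : o.C m →+ o.C n →+ o.C (m + n - 1) :=
  ∑ i ∈ Finset.range m, o.compHom m n i

lemma tot_eq_totHom {m n : ℕ} (f : o.C m) (g : o.C n) : o.tot f g = o.totHom m n f g := by
  simp [tot, totHom, compHom, AddMonoidHom.finsetSum_apply]

lemma comp_sum_left {ι : Type*} {m n : ℕ} (s : Finset ι) (f : ι → o.C m) (i : ℕ) (g : o.C n) :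
    o.comp (∑ a ∈ s, f a) i g = ∑ a ∈ s, o.comp (f a) i g :=
  map_sum ((o.compHom m n i).flip g) f s

lemma comp_sum_right {ι : Type*} {m n : ℕ} (s : Finset ι) (f : o.C m) (i : ℕ) (g : ι → o.C n) :
    o.comp f i (∑ a ∈ s, g a) = ∑ a ∈ s, o.comp f i (g a) :=
  map_sum (o.compHom m n i f) g s

lemma tot_nCast_left {m m' n : ℕ} (e : m = m') (f : o.C m) (g : o.C n) :
    o.tot (o.nCast e f) g = o.nCast (by rw [e]) (o.tot f g) := by
  subst e; rfl

lemma tot_nCast_right {m n n' : ℕ} (e : n = n') (f : o.C m) (g : o.C n) :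
    o.tot f (o.nCast e g) = o.nCast (by rw [e]) (o.tot f g) := by
  subst e; rfl

lemma tot_sub_zsmul_left {m n : ℕ} (a : ℤ) (f₁ f₂ : o.C m) (g : o.C n) :
    o.tot (f₁ - a • f₂) g = o.tot f₁ g - a • o.tot f₂ g := by
  simp [tot_eq_totHom]

lemma tot_sub_zsmul_right {m n : ℕ} (a : ℤ) (f : o.C m) (g₁ g₂ : o.C n) :
    o.tot f (g₁ - a • g₂) = o.tot f g₁ - a • o.tot f g₂ := by
  simp [tot_eq_totHom]

lemma incl_comp_comp_of_lt {p m n : ℕ} (h : o.C p) (f : o.C m) (g : o.C n) {i j : ℕ}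
    (hji : j < i) (hip : i < p) (hn : 1 ≤ n) :
    o.incl _ (o.comp (o.comp h i f) j g) =
      ((-1 : ℤ) ^ ((m + 1) * (n + 1))) • o.incl _ (o.comp (o.comp h j g) (i + n - 1) f) := by
  rw [← map_zsmul]
  exact (congrArg (o.incl _) (o.assoc₁ h f g i j hji hip hn)).trans (o.incl_nCast _ _)

lemma incl_comp_comp_nested {p m n : ℕ} (h : o.C p) (f : o.C m) (g : o.C n) {i j : ℕ}
    (hip : i < p) (hj : j < m) :
    o.incl _ (o.comp (o.comp h i f) (i + j) g) = o.incl _ (o.comp h i (o.comp f j g)) := by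
  have := (congrArg (o.incl _) (o.assoc₂ h f g i (i + j) hip (by omega) (by omega)
    (by omega))).trans (o.incl_nCast _ _)
  rwa [Nat.add_sub_cancel_left] at this

/-- The part of `(h•f)•g` in which `g` is inserted to the left of `f`. -/
def leftPart {p m n : ℕ} (h : o.C p) (f : o.C m) (g : o.C n) : ∀ k, o.C k :=
  ∑ i ∈ Finset.range p, ∑ j ∈ Finset.range i, o.incl _ (o.comp (o.comp h i f) j g)

/-- The part of `(h•f)•g` in which `g` is inserted to the right of `f`. -/
def rightPart {p m n : ℕ} (h : o.C p) (f : o.C m) (g : o.C n) : ∀ k, o.C k :=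
  ∑ i ∈ Finset.range p, ∑ j ∈ Finset.range (p - 1 - i),
    o.incl _ (o.comp (o.comp h i f) (i + m + j) g)

lemma incl_tot_tot {p m n : ℕ} (hm : 1 ≤ m) (h : o.C p) (f : o.C m) (g : o.C n) :
    o.incl _ (o.tot (o.tot h f) g) =
      o.leftPart h f g + o.incl _ (o.tot h (o.tot f g)) + o.rightPart h f g := by
  simp only [tot, leftPart, rightPart, comp_sum_left, comp_sum_right, map_sum]
  rw [Finset.sum_comm, ← Finset.sum_add_distrib, ← Finset.sum_add_distrib]
  refine Finset.sum_congr rfl fun i hi => ?_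
  rw [Finset.mem_range] at hi
  have range_eq : Finset.range (p + m - 1) = Finset.range (i + m + (p - 1 - i)) := by
    congr 1
    omega
  rw [range_eq, Finset.sum_range_add, Finset.sum_range_add]
  congr 2
  exact Finset.sum_congr rfl fun j hj =>
    o.incl_comp_comp_nested h f g hi (Finset.mem_range.1 hj)

lemma leftPart_eq {p m n : ℕ} (hn : 1 ≤ n) (h : o.C p) (f : o.C m) (g : o.C n) :
    o.leftPart h f g = ((-1 : ℤ) ^ ((m + 1) * (n + 1))) • o.rightPart h g f := by
  simp only [leftPart, rightPart, Finset.smul_sum]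
  rw [Finset.sum_sigma', Finset.sum_sigma']
  refine Finset.sum_bij' (fun x _ => ⟨x.2, x.1 - x.2 - 1⟩) (fun y _ => ⟨y.1 + y.2 + 1, y.1⟩)
    ?_ ?_ ?_ ?_ ?_
  · rintro ⟨i, j⟩ hx
    simp only [Finset.mem_sigma, Finset.mem_range] at hx ⊢
    omega
  · rintro ⟨i, j⟩ hx
    simp only [Finset.mem_sigma, Finset.mem_range] at hx ⊢
    omega
  · rintro ⟨i, j⟩ hx
    simp only [Finset.mem_sigma, Finset.mem_range] at hx
    simp only [Sigma.mk.injEq, heq_eq_eq, and_true]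
    omega
  · rintro ⟨i, j⟩ hx
    simp only [Sigma.mk.injEq, heq_eq_eq, true_and]
    omega
  · rintro ⟨i, j⟩ hx
    simp only [Finset.mem_sigma, Finset.mem_range] at hx
    rw [o.incl_comp_comp_of_lt h f g hx.2 hx.1 hn,
      show j + n + (i - j - 1) = i + n - 1 by omega]

/-- The Gerstenhaber identity. -/
lemma gerstenhaber {p m n : ℕ} (hm : 1 ≤ m) (hn : 1 ≤ n) (h : o.C p) (f : o.C m) (g : o.C n) :
    o.incl _ (o.tot (o.tot h f) g) - o.incl _ (o.tot h (o.tot f g)) =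
      ((-1 : ℤ) ^ ((m + 1) * (n + 1))) •
        (o.incl _ (o.tot (o.tot h g) f) - o.incl _ (o.tot h (o.tot g f))) := by
  rw [o.incl_tot_tot hm, o.incl_tot_tot hn, o.leftPart_eq hn h f g, o.leftPart_eq hm h g f,
    mul_comm (n + 1)]
  rcases neg_one_pow_eq_or ℤ ((m + 1) * (n + 1)) with e | e <;> rw [e] <;> module

lemma incl_bracket {m n : ℕ} (f : o.C m) (g : o.C n) :
    o.incl _ (o.bracket f g) = o.incl _ (o.tot f g) -
      ((-1 : ℤ) ^ ((m + 1) * (n + 1))) • o.incl _ (o.tot g f) := by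
  simp [bracket]

lemma incl_bracket_bracket {m n q : ℕ} (hm : 1 ≤ m) (f : o.C m) (g : o.C n) (h : o.C q) :
    o.incl _ (o.bracket (o.bracket f g) h) =
      o.incl _ (o.tot (o.tot f g) h) -
      ((-1 : ℤ) ^ ((m + 1) * (n + 1))) • o.incl _ (o.tot (o.tot g f) h) -
      ((-1 : ℤ) ^ ((m + 1) * (q + 1)) * (-1 : ℤ) ^ ((n + 1) * (q + 1))) •
        (o.incl _ (o.tot h (o.tot f g)) -
          ((-1 : ℤ) ^ ((m + 1) * (n + 1))) • o.incl _ (o.tot h (o.tot g f))) := by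
  have sign : (-1 : ℤ) ^ ((m + n - 1 + 1) * (q + 1)) =
      (-1 : ℤ) ^ ((m + 1) * (q + 1)) * (-1 : ℤ) ^ ((n + 1) * (q + 1)) := by
    rw [← pow_add, show m + n - 1 + 1 = m + n by omega,
      show (m + 1) * (q + 1) + (n + 1) * (q + 1) = (m + n) * (q + 1) + 2 * (q + 1) by ring,
      pow_add, pow_mul _ 2]
    simp
  rw [incl_bracket, sign]
  simp only [bracket, tot_sub_zsmul_left, tot_sub_zsmul_right, tot_nCast_left, tot_nCast_right,
    map_sub, map_zsmul, incl_nCast]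

/-- The commutator `[f,g] := f•g - (-1)^{|f||g|} g•f` makes `C` a graded Lie
algebra w.r.t. reduced degree: graded anticommutativity and the graded Jacobi
identity `(-1)^{|f||h|}[[f,g],h] + (-1)^{|g||f|}[[g,h],f] + (-1)^{|h||g|}[[h,f],g] = 0`. -/
theorem bracket_gradedLie {m n q : ℕ} (hm : 1 ≤ m) (hn : 1 ≤ n) (hq : 1 ≤ q)
    (f : o.C m) (g : o.C n) (h : o.C q) :
    (o.bracket f g =
        -(((-1 : ℤ) ^ ((m + 1) * (n + 1))) • o.nCast (by omega) (o.bracket g f))) ∧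
    (((-1 : ℤ) ^ ((m + 1) * (q + 1))) • o.bracket (o.bracket f g) h +
      ((-1 : ℤ) ^ ((n + 1) * (m + 1))) • o.nCast (by omega) (o.bracket (o.bracket g h) f) +
      ((-1 : ℤ) ^ ((q + 1) * (n + 1))) • o.nCast (by omega) (o.bracket (o.bracket h f) g)
        = 0) := by
  constructor
  · apply o.incl_injective
    rw [map_neg, map_zsmul, incl_nCast, incl_bracket, incl_bracket, mul_comm (n + 1)]
    rcases neg_one_pow_eq_or ℤ ((m + 1) * (n + 1)) with e | e <;> rw [e] <;> module
  · apply o.incl_injective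
    simp only [map_add, map_zsmul, incl_nCast, map_zero, o.incl_bracket_bracket hm,
      o.incl_bracket_bracket hn, o.incl_bracket_bracket hq]
    have H := o.gerstenhaber hm hn h f g
    have F := o.gerstenhaber hn hq f g h
    have G := o.gerstenhaber hq hm g h f
    simp only [mul_comm (n + 1) (m + 1), mul_comm (q + 1) (m + 1), mul_comm (q + 1) (n + 1)]
      at H F G ⊢
    have hx := neg_one_pow_eq_or ℤ ((m + 1) * (n + 1))
    have hy := neg_one_pow_eq_or ℤ ((n + 1) * (q + 1))
    have hz := neg_one_pow_eq_or ℤ ((m + 1) * (q + 1))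
    generalize (-1 : ℤ) ^ ((m + 1) * (n + 1)) = x at *
    generalize (-1 : ℤ) ^ ((n + 1) * (q + 1)) = y at *
    generalize (-1 : ℤ) ^ ((m + 1) * (q + 1)) = z at *
    linear_combination (norm := skip) y • H + z • F + x • G
    rcases hx with rfl | rfl <;> rcases hy with rfl | rfl <;> rcases hz with rfl | rfl <;> module

end PreOperad
end
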